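/- Let 𝒜 be a ℂ-linear abelian category with finite-dimensional Hom- and Ext¹-spaces, (E₁,…,E_k) a simple collection, (E_i^{(n)})_{n≥0} a universal-extension tower on it, and E^{(n)} = ⊕_{i=1}^k E_i^{(n)}. Then for every short exact sequence 0 → U′ → U → U″ → 0 with U′, U, U″ in the extension closure ⟨E₁,…,E_k⟩, there exists n₀ such that for all n ≥ n₀ the induced sequence 0 → Hom(E^{(n)}, U′) → Hom(E^{(n)}, U) → Hom(E^{(n)}, U″) → 0 is exact; in particular the map Hom(E^{(n)}, U) → Hom(E^{(n)}, U″) is surjective for n sufficiently large. Consequently the functor Ψ(U) = Hom(E^{(n)}, U) for n ≫ 0 is exact on the extension closure. -/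

import Mathlib

open CategoryTheory CategoryTheory.Limits CategoryTheory.Abelian

attribute [local instance] CategoryTheory.Abelian.hasFiniteBiproducts

universe w v u

/-- The extension closure of a class of objects `P` in an abelian category: the smallest
class of objects containing the objects satisfying `P` and closed under extensions. -/
inductive ExtClosure {C : Type u} [Category.{v} C] [Abelian C] (P : C → Prop) : C → Prop
  | base (X : C) : P X → ExtClosure P X
  | ext (S : ShortComplex C) : S.ShortExact → ExtClosure P S.X₁ → ExtClosure P S.X₃ →
      ExtClosure P S.X₂

/-- Composites of transition maps of a tower. -/
inductive TowerMap {C : Type u} [Category.{v} C] (T : ℕ → C) (π : ∀ n, T (n + 1) ⟶ T n)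
    (n : ℕ) : ∀ N : ℕ, (T N ⟶ T n) → Prop
  | id : TowerMap T π n n (𝟙 (T n))
  | step (N : ℕ) (q : T N ⟶ T n) : TowerMap T π n N q → TowerMap T π n (N + 1) (π N ≫ q)

theorem TowerMap.comp {C : Type u} [Category.{v} C] {T : ℕ → C} {π : ∀ n, T (n + 1) ⟶ T n}
    {n m : ℕ} {q : T m ⟶ T n} (hq : TowerMap T π n m q) :
    ∀ {N : ℕ} {r : T N ⟶ T m}, TowerMap T π m N r → TowerMap T π n N (r ≫ q) := by
  intro N r hr
  induction hr with
  | id => simpa using hq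
  | step N r _ ih => simpa using TowerMap.step N _ ih

theorem TowerMap.epi {C : Type u} [Category.{v} C] {T : ℕ → C} {π : ∀ n, T (n + 1) ⟶ T n}
    (hπ : ∀ n, Epi (π n)) {n N : ℕ} {q : T N ⟶ T n} (hq : TowerMap T π n N q) : Epi q := by
  induction hq with
  | id => infer_instance
  | step N r _ ih =>
    have := hπ N
    exact epi_comp _ _

theorem TowerMap.le {C : Type u} [Category.{v} C] {T : ℕ → C} {π : ∀ n, T (n + 1) ⟶ T n}
    {n N : ℕ} {q : T N ⟶ T n} (hq : TowerMap T π n N q) : n ≤ N := by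
  induction hq with
  | id => exact le_rfl
  | step N r _ ih => omega

theorem TowerMap.factor {C : Type u} [Category.{v} C] {T : ℕ → C} {π : ∀ n, T (n + 1) ⟶ T n}
    {X : C} {n N : ℕ} {q : T N ⟶ T n} (hq : TowerMap T π n N q)
    (h : ∀ m, n ≤ m → ∀ φ : T (m + 1) ⟶ X, ∃ ψ : T m ⟶ X, π m ≫ ψ = φ) :
    ∀ φ : T N ⟶ X, ∃ ψ : T n ⟶ X, q ≫ ψ = φ := by
  induction hq with
  | id => exact fun φ => ⟨φ, by simp⟩
  | step N r hr ih =>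
    intro φ
    obtain ⟨φ', h1⟩ := h N hr.le φ
    obtain ⟨ψ, h2⟩ := ih φ'
    exact ⟨ψ, by simp [h2, h1]⟩

/-- Every degree one class with values in the extension closure dies up the tower. -/
theorem tower_kill {C : Type u} [Category.{v} C] [Abelian C] [HasExt.{w} C]
    (T : ℕ → C) (π : ∀ n, T (n + 1) ⟶ T n) (P : C → Prop)
    (hP : ∀ X, P X → ∀ n (e : Ext (T n) X 1), (Ext.mk₀ (π n)).comp e (zero_add 1) = 0)
    (U : C) (hU : ExtClosure P U) :
    ∀ n, ∃ (N : ℕ) (q : T N ⟶ T n), TowerMap T π n N q ∧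
      ∀ e : Ext (T n) U 1, (Ext.mk₀ q).comp e (zero_add 1) = 0 := by
  induction hU with
  | base X hX =>
    intro n
    refine ⟨n + 1, π n ≫ 𝟙 _, TowerMap.step _ _ TowerMap.id, fun e => ?_⟩
    rw [Category.comp_id]
    exact hP X hX n e
  | ext S hS _ _ ih1 ih3 =>
    intro n
    obtain ⟨m, q, hq, h3⟩ := ih3 n
    obtain ⟨N, r, hr, h1⟩ := ih1 m
    refine ⟨N, r ≫ q, hq.comp hr, fun e => ?_⟩
    obtain ⟨e1, he1⟩ := Ext.covariant_sequence_exact₂ _ hS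
      ((Ext.mk₀ q).comp e (zero_add 1)) (by
        rw [Ext.comp_assoc_of_third_deg_zero]
        exact h3 _)
    rw [← Ext.mk₀_comp_mk₀_assoc, ← he1, ← Ext.comp_assoc_of_third_deg_zero, h1, Ext.zero_comp]

/-- Dimensions of Hom spaces into an object of the extension closure are bounded. -/
theorem tower_bound {C : Type u} [Category.{v} C] [Abelian C] [Linear ℂ C]
    (hfd : ∀ X Y : C, FiniteDimensional ℂ (X ⟶ Y))
    (T : ℕ → C) (P : C → Prop)
    (hP : ∀ X, P X → ∃ B : ℕ, ∀ n, Module.finrank ℂ (T n ⟶ X) ≤ B)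
    (U : C) (hU : ExtClosure P U) :
    ∃ B : ℕ, ∀ n, Module.finrank ℂ (T n ⟶ U) ≤ B := by
  induction hU with
  | base X hX => exact hP X hX
  | ext S hS _ _ ih1 ih3 =>
    obtain ⟨B1, h1⟩ := ih1
    obtain ⟨B3, h3⟩ := ih3
    refine ⟨B1 + B3, fun n => ?_⟩
    have := hfd (T n) S.X₁
    have := hfd (T n) S.X₂
    have := hfd (T n) S.X₃
    have e := LinearMap.finrank_range_add_finrank_ker (Linear.rightComp ℂ (T n) S.g)
    have hr : Module.finrank ℂ (LinearMap.range (Linear.rightComp ℂ (T n) S.g)) ≤ B3 :=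
      (Submodule.finrank_le _).trans (h3 n)
    have hle : LinearMap.ker (Linear.rightComp ℂ (T n) S.g) ≤
        LinearMap.range (Linear.rightComp ℂ (T n) S.f) := by
      intro φ hφ
      have hφ' : φ ≫ S.g = 0 := hφ
      have := hS.mono_f
      exact ⟨hS.exact.lift φ hφ', hS.exact.lift_f φ hφ'⟩
    have hk := (Submodule.finrank_mono hle).trans (LinearMap.finrank_range_le _)
    have := h1 n
    omega

/-- Hom spaces into an object of the extension closure stabilise. -/
theorem tower_stab {C : Type u} [Category.{v} C] [Abelian C] [Linear ℂ C]
    (hfd : ∀ X Y : C, FiniteDimensional ℂ (X ⟶ Y))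
    (T : ℕ → C) (π : ∀ n, T (n + 1) ⟶ T n) (hπ : ∀ n, Epi (π n)) (U : C)
    (hB : ∃ B : ℕ, ∀ n, Module.finrank ℂ (T n ⟶ U) ≤ B) :
    ∃ n₀, ∀ n, n₀ ≤ n → ∀ φ : T (n + 1) ⟶ U, ∃ ψ : T n ⟶ U, π n ≫ ψ = φ := by
  obtain ⟨B, hB⟩ := hB
  have hinj : ∀ n, Function.Injective (Linear.leftComp ℂ U (π n)) := by
    intro n a b hab
    have := hπ n
    exact (cancel_epi (π n)).1 hab
  have hmono : Monotone (fun n => Module.finrank ℂ (T n ⟶ U)) := by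
    refine monotone_nat_of_le_succ fun n => ?_
    have := hfd (T (n + 1)) U
    exact LinearMap.finrank_le_finrank_of_injective (hinj n)
  obtain ⟨n₀, hn₀⟩ : ∃ n₀, ∀ n, B - Module.finrank ℂ (T n₀ ⟶ U) ≤
      B - Module.finrank ℂ (T n ⟶ U) :=
    ⟨_, fun n => Function.argmin_le (fun n => B - Module.finrank ℂ (T n ⟶ U)) n⟩
  refine ⟨n₀, fun n hn φ => ?_⟩
  have e : Module.finrank ℂ (T n ⟶ U) = Module.finrank ℂ (T (n + 1) ⟶ U) := by
    have a1 := hmono hn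
    have a2 := hmono (Nat.le_succ n)
    have a3 := hn₀ (n + 1)
    have a4 := hB (n + 1)
    have a5 := hB n
    have a6 := hB n₀
    simp only [Nat.succ_eq_add_one] at a1 a2
    omega
  have := hfd (T (n + 1)) U
  have := hfd (T n) U
  exact (LinearMap.injective_iff_surjective_of_finrank_eq_finrank e).1 (hinj n) φ

/-- Surjectivity along a single tower. -/
theorem tower_surj {C : Type u} [Category.{v} C] [Abelian C] [Linear ℂ C] [HasExt.{w} C]
    (hfd : ∀ X Y : C, FiniteDimensional ℂ (X ⟶ Y))
    (T : ℕ → C) (π : ∀ n, T (n + 1) ⟶ T n) (hπ : ∀ n, Epi (π n)) (P : C → Prop)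
    (hP : ∀ X, P X → ∀ n (e : Ext (T n) X 1), (Ext.mk₀ (π n)).comp e (zero_add 1) = 0)
    (hP' : ∀ X, P X → ∀ n (φ : T (n + 1) ⟶ X), ∃ ψ : T n ⟶ X, π n ≫ ψ = φ)
    (S : ShortComplex C) (hS : S.ShortExact) (h1 : ExtClosure P S.X₁)
    (h2 : ExtClosure P S.X₂) :
    ∃ n₀, ∀ n, n₀ ≤ n → ∀ φ : T n ⟶ S.X₃, ∃ ψ : T n ⟶ S.X₂, ψ ≫ S.g = φ := by
  have hB := tower_bound hfd T P (fun X hX => ⟨Module.finrank ℂ (T 0 ⟶ X), fun n => by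
    induction n with
    | zero => exact le_rfl
    | succ n ih =>
      refine le_trans ?_ ih
      have := hfd (T n) X
      have hs : Function.Surjective (Linear.leftComp ℂ X (π n)) := hP' X hX n
      exact LinearMap.finrank_le_finrank_of_surjective hs⟩) S.X₂ h2
  obtain ⟨n₀, hn₀⟩ := tower_stab hfd T π hπ S.X₂ hB
  refine ⟨n₀, fun n hn φ => ?_⟩
  obtain ⟨N, q, hq, hk⟩ := tower_kill T π P hP S.X₁ h1 n
  obtain ⟨x, hx⟩ := Ext.covariant_sequence_exact₃ _ hS (Ext.mk₀ (q ≫ φ)) (zero_add 1) (by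
    rw [← Ext.mk₀_comp_mk₀_assoc]
    exact hk _)
  obtain ⟨χ, rfl⟩ := (Ext.mk₀_bijective _ _).2 x
  rw [Ext.mk₀_comp_mk₀] at hx
  have hχ := (Ext.mk₀_bijective _ _).1 hx
  obtain ⟨ψ, hψ⟩ := hq.factor (fun m hm => hn₀ m (hn.trans hm)) χ
  have := hq.epi hπ
  refine ⟨ψ, (cancel_epi q).1 ?_⟩
  rw [← Category.assoc, hψ, hχ]

/-- Let `𝒜` be a `ℂ`-linear abelian category with finite-dimensional Hom-spaces,
`(E₁, …, E_k)` (here `E_i = T i 0`) a simple collection, `(T i n)ₙ` a universal-extension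
tower on it, and `E⁽ⁿ⁾ = ⊕ᵢ T i n`.  Then for every short exact sequence
`0 → U' → U → U'' → 0` with `U', U, U''` in the extension closure `⟨E₁, …, E_k⟩`, there
exists `n₀` such that for all `n ≥ n₀` the induced sequence
`0 → Hom(E⁽ⁿ⁾, U') → Hom(E⁽ⁿ⁾, U) → Hom(E⁽ⁿ⁾, U'') → 0` is exact; in particular the map
`Hom(E⁽ⁿ⁾, U) → Hom(E⁽ⁿ⁾, U'')` is surjective for `n` sufficiently large.  Consequently
the functor `Ψ(U) = Hom(E⁽ⁿ⁾, U)` for `n ≫ 0` is exact on the extension closure. -/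
theorem stmt11 {𝒜 : Type u} [Category.{v} 𝒜] [Abelian 𝒜] [Linear ℂ 𝒜] [HasExt.{w} 𝒜]
    (hfd : ∀ X Y : 𝒜, FiniteDimensional ℂ (X ⟶ Y))
    (k : ℕ) (T : Fin k → ℕ → 𝒜)
    (hsimple₁ : ∀ i : Fin k, Module.finrank ℂ (T i 0 ⟶ T i 0) = 1)
    (hsimple₂ : ∀ i j : Fin k, i ≠ j → ∀ f : T i 0 ⟶ T j 0, f = 0)
    (K : Fin k → ℕ → 𝒜)
    (ι : ∀ (i : Fin k) (n : ℕ), K i n ⟶ T i (n + 1))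
    (π : ∀ (i : Fin k) (n : ℕ), T i (n + 1) ⟶ T i n)
    (hw : ∀ i n, ι i n ≫ π i n = 0)
    (hses : ∀ i n, (ShortComplex.mk (ι i n) (π i n) (hw i n)).ShortExact)
    (hK : ∀ i n, ∃ c : Fin k → ℕ,
      Nonempty (K i n ≅ ⨁ (fun p : Σ j : Fin k, Fin (c j) => T p.1 0)))
    (hconn : ∀ (i : Fin k) (n : ℕ) (j : Fin k), Function.Bijective
      (fun φ : K i n ⟶ T j 0 => (hses i n).extClass.comp (Ext.mk₀ φ) (add_zero 1)))
    (U' U U'' : 𝒜) (f : U' ⟶ U) (g : U ⟶ U'') (hfg : f ≫ g = 0)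
    (hUses : (ShortComplex.mk f g hfg).ShortExact)
    (hU' : ExtClosure (fun Z => ∃ i : Fin k, Z = T i 0) U')
    (hU : ExtClosure (fun Z => ∃ i : Fin k, Z = T i 0) U)
    (hU'' : ExtClosure (fun Z => ∃ i : Fin k, Z = T i 0) U'') :
    ∃ n₀ : ℕ, ∀ n : ℕ, n₀ ≤ n →
      Function.Injective
        (fun φ : (⨁ fun i : Fin k => T i n) ⟶ U' => φ ≫ f) ∧
      (∀ φ : (⨁ fun i : Fin k => T i n) ⟶ U,
        φ ≫ g = 0 → ∃ ψ : (⨁ fun i : Fin k => T i n) ⟶ U', ψ ≫ f = φ) ∧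
      Function.Surjective
        (fun φ : (⨁ fun i : Fin k => T i n) ⟶ U => φ ≫ g) := by
  have hmono : Mono f := hUses.mono_f
  have key : ∀ i, ∃ n₀, ∀ n, n₀ ≤ n → ∀ φ : T i n ⟶ U'', ∃ ψ : T i n ⟶ U, ψ ≫ g = φ := by
    intro i
    refine tower_surj.{w} hfd (T i) (π i) (fun n => (hses i n).epi_g)
      (fun Z => ∃ i : Fin k, Z = T i 0) ?_ ?_ _ hUses hU' hU
    · rintro _ ⟨j, rfl⟩ n e
      obtain ⟨φ, rfl⟩ := (hconn i n j).2 e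
      exact (hses i n).comp_extClass_assoc _ _
    · rintro _ ⟨j, rfl⟩ n φ
      have h0 : ι i n ≫ φ = 0 := by
        apply (hconn i n j).1
        simp only [Ext.mk₀_zero, Ext.comp_zero]
        rw [← Ext.mk₀_comp_mk₀]
        exact (hses i n).extClass_comp_assoc _
      have := (hses i n).epi_g
      exact ⟨(hses i n).exact.desc φ h0, (hses i n).exact.g_desc φ h0⟩
  choose N hN using key
  refine ⟨Finset.univ.sup N, fun n hn => ⟨?_, ?_, ?_⟩⟩
  · intro a b hab
    exact (cancel_mono f).1 hab
  · intro φ hφ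
    exact ⟨hUses.exact.lift φ hφ, hUses.exact.lift_f φ hφ⟩
  · intro φ
    choose ψ hψ using fun i => hN i n ((Finset.le_sup (Finset.mem_univ i)).trans hn)
      (biproduct.ι (fun i : Fin k => T i n) i ≫ φ)
    refine ⟨biproduct.desc ψ, ?_⟩
    apply biproduct.hom_ext'
    intro i
    simp [hψ]
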